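/- Let β be a non-increasing weight sequence, U, Y complex Hilbert spaces, z_1,…,z_k points of 𝔻 and V_1,…,V_k ∈ L(U,Y). Then there exists an analytic S : 𝔻 → L(U,Y) which is a contractive multiplier from H²(U) to H²_β(Y) and satisfies S(z_i) = V_i for i = 1,…,k if and only if the k×k block operator Pick matrix P = [ k_β(z_i, conj z_l)·I_Y − (1 − z_i·conj z_l)^{-1} V_i V_l* ]_{i,l=1}^{k}, where k_β(z, conj ζ) = Σ_{j≥0} β_j^{-1} z^j (conj ζ)^j, is positive semidefinite, i.e., Σ_{i,l=1}^{k} ⟨( k_β(z_i, conj z_l)·I_Y − (1 − z_i·conj z_l)^{-1} V_i V_l* ) y_l, y_i⟩ ≥ 0 for all y_1,…,y_k ∈ Y. -/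

import Mathlib

open Metric Filter

noncomputable section

/-- `β` is a weight sequence: positive, `β 0 = 1`, and `liminf β_j^(1/j) ≥ 1`. -/
def IsWeightSeq (β : ℕ → ℝ) : Prop :=
  (∀ j, 0 < β j) ∧ β 0 = 1 ∧
    1 ≤ Filter.liminf (fun j : ℕ => β j ^ ((1 : ℝ) / j)) Filter.atTop

/-- `S`, with Taylor coefficients `Sc`, is a contractive multiplier from `H²(U)` to
`H²_β(Y)`. -/
def IsContractiveMultiplier {U Y : Type*} [NormedAddCommGroup U] [InnerProductSpace ℂ U]
    [NormedAddCommGroup Y] [InnerProductSpace ℂ Y]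
    (β : ℕ → ℝ) (Sc : ℕ → (U →L[ℂ] Y)) : Prop :=
  ∀ h : ℕ → U, Summable (fun k => ‖h k‖ ^ 2) →
    Summable (fun ℓ => β ℓ * ‖∑ j ∈ Finset.range (ℓ + 1), Sc j (h (ℓ - j))‖ ^ 2) ∧
    ∑' ℓ, β ℓ * ‖∑ j ∈ Finset.range (ℓ + 1), Sc j (h (ℓ - j))‖ ^ 2 ≤ ∑' k, ‖h k‖ ^ 2

theorem IsWeightSeq.summable_inv_mul_pow {β : ℕ → ℝ} (hβ : IsWeightSeq β) {r : ℝ}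
    (hr0 : 0 ≤ r) (hr1 : r < 1) : Summable fun j => (β j)⁻¹ * r ^ j := by
  obtain ⟨ρ, hρ, hρ1⟩ := exists_between hr1
  have hρ0 : 0 < ρ := hr0.trans_lt hρ
  have hbdd : (atTop : Filter ℕ).IsBoundedUnder (· ≥ ·)
      (fun j : ℕ => β j ^ ((1 : ℝ) / j)) :=
    isBoundedUnder_of ⟨0, fun j => Real.rpow_nonneg (hβ.1 j).le _⟩
  have hlt := eventually_lt_of_lt_liminf (hρ1.trans_le hβ.2.2) hbdd
  refine Summable.of_norm_bounded_eventually_nat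
    (g := fun j => (r / ρ) ^ j)
    (summable_geometric_of_lt_one (by positivity) ((div_lt_one hρ0).2 hρ)) ?_
  filter_upwards [hlt, eventually_ge_atTop 1] with j hj hj1
  have hj0 : (j : ℝ) ≠ 0 := by positivity
  have hpow : ρ ^ j ≤ β j := by
    have h := pow_le_pow_left₀ hρ0.le hj.le j
    rwa [← Real.rpow_natCast (β j ^ _), ← Real.rpow_mul (hβ.1 j).le, one_div,
      inv_mul_cancel₀ hj0, Real.rpow_one] at h
  have hβj := hβ.1 j
  rw [Real.norm_of_nonneg (by positivity), div_pow, div_eq_inv_mul]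
  gcongr

theorem HasSum.sum_range_antidiagonal {X : Type*} [AddCommGroup X] [UniformSpace X]
    [IsUniformAddGroup X] [CompleteSpace X] [T2Space X] {a : ℕ × ℕ → X} {s : X}
    (ha : HasSum a s) : HasSum (fun n => ∑ j ∈ Finset.range (n + 1), a (j, n - j)) s := by
  have h := (Finset.HasAntidiagonal.sigmaAntidiagonalEquivProd (A := ℕ)).hasSum_iff.2 ha
  have h2 := h.sigma (fun n => hasSum_fintype _)
  convert h2 using 1
  funext n
  rw [← Finset.Nat.sum_antidiagonal_eq_sum_range_succ (fun i j => a (i, j)),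
    ← Finset.sum_coe_sort]
  rfl

/-- A form of the Douglas lemma: a linear map dominated in norm by another one factors through it
by a contraction. -/
theorem exists_contraction_comp_eq {X M N : Type*} [AddCommGroup X] [Module ℂ X]
    [NormedAddCommGroup M] [InnerProductSpace ℂ M] [CompleteSpace M]
    [NormedAddCommGroup N] [NormedSpace ℂ N] [CompleteSpace N]
    (a : X →ₗ[ℂ] M) (b : X →ₗ[ℂ] N) (hab : ∀ x, ‖b x‖ ≤ ‖a x‖) :
    ∃ W : M →L[ℂ] N, (∀ m, ‖W m‖ ≤ ‖m‖) ∧ ∀ x, W (a x) = b x := by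
  let R := (LinearMap.range a).topologicalClosure
  have hR : ∀ x, a x ∈ R := fun x =>
    Submodule.le_topologicalClosure _ (LinearMap.mem_range_self a x)
  let a' : X →ₗ[ℂ] R := a.codRestrict R hR
  have hdense : DenseRange a' := by
    intro m
    rw [closure_subtype, ← Set.range_comp]
    exact m.2
  have hn : ∀ x, ‖b x‖ ≤ 1 * ‖a' x‖ := fun x => by simpa [a'] using hab x
  have : CompleteSpace R := (Submodule.isClosed_topologicalClosure _).completeSpace_coe
  refine ⟨(b.extendOfNorm a') ∘L R.orthogonalProjectionOnto, fun m => ?_, fun x => ?_⟩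
  · refine (LinearMap.norm_extendOfNorm_apply_le hdense 1 hn _).trans ?_
    rw [one_mul]
    exact R.norm_orthogonalProjectionOnto_apply_le m
  · have h : R.orthogonalProjectionOnto (a x) = a' x :=
      Submodule.orthogonalProjectionOnto_mem_subspace_eq_self (a' x)
    rw [ContinuousLinearMap.comp_apply, h]
    exact LinearMap.extendOfNorm_eq hdense ⟨1, hn⟩ x

/-- The lurking isometry argument, in adjoint form. -/
theorem exists_contractive_colligation {X K U E : Type*} [AddCommGroup X] [Module ℂ X]
    [NormedAddCommGroup K] [InnerProductSpace ℂ K] [CompleteSpace K]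
    [NormedAddCommGroup U] [InnerProductSpace ℂ U] [CompleteSpace U]
    [NormedAddCommGroup E] [InnerProductSpace ℂ E] [CompleteSpace E]
    (Q Q' : X →ₗ[ℂ] K) (R : X →ₗ[ℂ] U) (G : X →ₗ[ℂ] E)
    (h : ∀ x, ‖Q x‖ ^ 2 + ‖R x‖ ^ 2 = ‖Q' x‖ ^ 2 + ‖G x‖ ^ 2) :
    ∃ (A : K →L[ℂ] K) (B : U →L[ℂ] K) (C : K →L[ℂ] E) (D : U →L[ℂ] E),
      (∀ p u, ‖A p + B u‖ ^ 2 + ‖C p + D u‖ ^ 2 ≤ ‖p‖ ^ 2 + ‖u‖ ^ 2) ∧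
      ∀ x p u, inner ℂ (Q' x) (A p + B u) + inner ℂ (G x) (C p + D u)
        = inner ℂ (Q x) p + inner ℂ (R x) u := by
  let a : X →ₗ[ℂ] WithLp 2 (K × E) :=
    (WithLp.linearEquiv 2 ℂ (K × E)).symm.toLinearMap ∘ₗ Q'.prod G
  let b : X →ₗ[ℂ] WithLp 2 (K × U) :=
    (WithLp.linearEquiv 2 ℂ (K × U)).symm.toLinearMap ∘ₗ Q.prod R
  have hab : ∀ x, ‖b x‖ ≤ ‖a x‖ := fun x => by
    refine le_of_sq_le_sq ?_ (norm_nonneg _)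
    rw [WithLp.prod_norm_sq_eq_of_L2, WithLp.prod_norm_sq_eq_of_L2]
    exact (h x).le
  obtain ⟨W, hW, hWab⟩ := exists_contraction_comp_eq a b hab
  let T := ContinuousLinearMap.adjoint W
  have hT : ∀ m, ‖T m‖ ≤ ‖m‖ := fun m => by
    have hn : ‖T‖ ≤ 1 := by
      rw [ContinuousLinearMap.adjoint.norm_map]
      exact W.opNorm_le_bound zero_le_one fun m => by simpa using hW m
    simpa using T.le_of_opNorm_le hn m
  let e := (WithLp.prodContinuousLinearEquiv 2 ℂ K U).symm.toContinuousLinearMap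
  let T₁ := WithLp.fstL 2 ℂ K E ∘L T ∘L e
  let T₂ := WithLp.sndL 2 ℂ K E ∘L T ∘L e
  have key : ∀ p u, (T₁ (p, 0) + T₁ (0, u) = (T (WithLp.toLp 2 (p, u))).fst) ∧
      (T₂ (p, 0) + T₂ (0, u) = (T (WithLp.toLp 2 (p, u))).snd) := fun p u => by
    rw [← map_add, ← map_add]
    simp [T₁, T₂, e]
  refine ⟨T₁ ∘L .inl ℂ K U, T₁ ∘L .inr ℂ K U, T₂ ∘L .inl ℂ K U, T₂ ∘L .inr ℂ K U,
    fun p u => ?_, fun x p u => ?_⟩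
  · simp only [ContinuousLinearMap.comp_apply, ContinuousLinearMap.inl_apply,
      ContinuousLinearMap.inr_apply, (key p u).1, (key p u).2]
    rw [← WithLp.prod_norm_sq_eq_of_L2]
    refine (pow_le_pow_left₀ (norm_nonneg _) (hT _) 2).trans_eq ?_
    exact WithLp.prod_norm_sq_eq_of_L2 _
  · simp only [ContinuousLinearMap.comp_apply, ContinuousLinearMap.inl_apply,
      ContinuousLinearMap.inr_apply, (key p u).1, (key p u).2]
    have h1 : inner ℂ (a x) (T (WithLp.toLp 2 (p, u))) = inner ℂ (b x) (WithLp.toLp 2 (p, u)) := by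
      rw [ContinuousLinearMap.adjoint_inner_right, hWab]
    rw [WithLp.prod_inner_apply, WithLp.prod_inner_apply] at h1
    exact h1

theorem inner_sum_conj_pow_smul {X : Type*} [NormedAddCommGroup X] [InnerProductSpace ℂ X]
    {k : ℕ} (z : Fin k → ℂ) (x : Fin k → X) (x' : X) (n : ℕ) :
    inner ℂ (∑ i, (starRingEnd ℂ (z i)) ^ n • x i) x' = ∑ i, inner ℂ (x i) (z i ^ n • x') := by
  rw [sum_inner]
  refine Finset.sum_congr rfl fun i _ => ?_
  rw [inner_smul_left, inner_smul_right, map_pow, Complex.conj_conj]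

theorem hasSum_kernel_form {X : Type*} [NormedAddCommGroup X] [InnerProductSpace ℂ X]
    {a : ℕ → ℝ} (ha : ∀ r : ℝ, 0 ≤ r → r < 1 → Summable fun j => ‖a j‖ * r ^ j)
    {k : ℕ} {z : Fin k → ℂ} (hz : ∀ i, z i ∈ ball (0 : ℂ) 1) (y : Fin k → X) :
    HasSum (fun j => ((a j * ‖∑ i, (starRingEnd ℂ (z i)) ^ j • y i‖ ^ 2 : ℝ) : ℂ))
      (∑ i, ∑ l, (∑' j, (a j : ℂ) * z i ^ j * (starRingEnd ℂ (z l)) ^ j) *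
        inner ℂ (y i) (y l)) := by
  have hs : ∀ i l, Summable fun j => (a j : ℂ) * z i ^ j * (starRingEnd ℂ (z l)) ^ j := by
    intro i l
    have hi := mem_ball_zero_iff.1 (hz i)
    have hl := mem_ball_zero_iff.1 (hz l)
    refine Summable.of_norm_bounded
      (ha (‖z i‖ * ‖z l‖) (by positivity) (by nlinarith [norm_nonneg (z i), norm_nonneg (z l)]))
      fun j => le_of_eq ?_
    simp [mul_pow, mul_assoc]
  have hterm : ∀ j, ((a j * ‖∑ i, (starRingEnd ℂ (z i)) ^ j • y i‖ ^ 2 : ℝ) : ℂ) =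
      ∑ i, ∑ l, (a j : ℂ) * z i ^ j * (starRingEnd ℂ (z l)) ^ j * inner ℂ (y i) (y l) := by
    intro j
    push_cast
    have h := inner_self_eq_norm_sq_to_K (𝕜 := ℂ) (∑ i, (starRingEnd ℂ (z i)) ^ j • y i)
    erw [← h]
    rw [inner_sum_conj_pow_smul, Finset.mul_sum]
    refine Finset.sum_congr rfl fun i _ => ?_
    rw [inner_smul_right, inner_sum, Finset.mul_sum, Finset.mul_sum]
    refine Finset.sum_congr rfl fun l _ => ?_
    rw [inner_smul_right]
    ring
  simp only [hterm]
  exact hasSum_sum fun i _ => hasSum_sum fun l _ =>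
    (hs i l).hasSum.mul_right (inner ℂ (y i) (y l))

theorem sum_range_apply_single {U Y : Type*} [NormedAddCommGroup U] [NormedSpace ℂ U]
    [NormedAddCommGroup Y] [NormedSpace ℂ Y] (L : ℕ → (U →L[ℂ] Y)) (u : U) (ℓ : ℕ) :
    ∑ j ∈ Finset.range (ℓ + 1), L j ((Pi.single 0 u : ℕ → U) (ℓ - j)) = L ℓ u := by
  rw [Finset.sum_range_succ, Finset.sum_eq_zero, zero_add, Nat.sub_self, Pi.single_eq_same]
  intro j hj
  have : ℓ - j ≠ 0 := by have := Finset.mem_range.1 hj; omega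
  rw [Pi.single_eq_of_ne this, map_zero]

theorem hasSum_norm_sq_single {U : Type*} [NormedAddCommGroup U] (u : U) :
    HasSum (fun k => ‖(Pi.single 0 u : ℕ → U) k‖ ^ 2) (‖u‖ ^ 2) := by
  have h := hasSum_single (f := fun k => ‖(Pi.single 0 u : ℕ → U) k‖ ^ 2) 0
    fun k hk => by simp [Pi.single_eq_of_ne hk]
  simpa using h

theorem IsWeightSeq.le_one {β : ℕ → ℝ} (hβ : IsWeightSeq β) (hmono : ∀ j, β (j + 1) ≤ β j)
    (j : ℕ) : β j ≤ 1 :=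
  hβ.2.1 ▸ antitone_nat_of_succ_le hmono (Nat.zero_le j)

section Multiplier

variable {U Y : Type*} [NormedAddCommGroup U] [InnerProductSpace ℂ U]
  [NormedAddCommGroup Y] [InnerProductSpace ℂ Y]

theorem IsContractiveMultiplier.norm_coeff_le {β : ℕ → ℝ} {Sc : ℕ → (U →L[ℂ] Y)}
    (h : IsContractiveMultiplier β Sc) (hβ : IsWeightSeq β) (hmono : ∀ j, β (j + 1) ≤ β j)
    (j : ℕ) : ‖Sc j‖ ≤ (β j)⁻¹ := by
  have hβj := hβ.1 j
  refine ContinuousLinearMap.opNorm_le_bound _ (by positivity) fun u => ?_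
  obtain ⟨h1, h2⟩ := h _ (hasSum_norm_sq_single u).summable
  simp only [sum_range_apply_single, (hasSum_norm_sq_single u).tsum_eq] at h1 h2
  have h3 : β j * ‖Sc j u‖ ^ 2 ≤ ‖u‖ ^ 2 :=
    (h1.le_tsum j fun i _ => by have := hβ.1 i; positivity).trans h2
  rw [← div_eq_inv_mul, le_div_iff₀ hβj]
  refine le_of_sq_le_sq ?_ (norm_nonneg _)
  calc (‖Sc j u‖ * β j) ^ 2 = β j * (β j * ‖Sc j u‖ ^ 2) := by ring
    _ ≤ 1 * ‖u‖ ^ 2 := by gcongr; exact hβ.le_one hmono j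
    _ = ‖u‖ ^ 2 := one_mul _

theorem IsContractiveMultiplier.summable_norm {β : ℕ → ℝ} {Sc : ℕ → (U →L[ℂ] Y)}
    (h : IsContractiveMultiplier β Sc) (hβ : IsWeightSeq β) (hmono : ∀ j, β (j + 1) ≤ β j)
    {w : ℂ} (hw : w ∈ ball (0 : ℂ) 1) : Summable fun j => ‖w ^ j • Sc j‖ := by
  refine Summable.of_nonneg_of_le (fun _ => norm_nonneg _) (fun j => ?_)
    (hβ.summable_inv_mul_pow (norm_nonneg w) (mem_ball_zero_iff.1 hw))
  rw [norm_smul, norm_pow, mul_comm]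
  gcongr
  exact h.norm_coeff_le hβ hmono j

theorem hasSum_pow_smul_sum_range [CompleteSpace Y] {w : ℂ} {Sc : ℕ → (U →L[ℂ] Y)}
    {S : U →L[ℂ] Y} (hS : HasSum (fun j => w ^ j • Sc j) S)
    (hSn : Summable fun j => ‖w ^ j • Sc j‖) {h : ℕ → U} {H : U}
    (hH : HasSum (fun n => w ^ n • h n) H) (hn : Summable fun n => ‖w ^ n • h n‖) :
    HasSum (fun ℓ => w ^ ℓ • ∑ j ∈ Finset.range (ℓ + 1), Sc j (h (ℓ - j))) (S H) := by
  have ha : Summable fun p : ℕ × ℕ => (w ^ p.1 • Sc p.1) (w ^ p.2 • h p.2) :=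
    Summable.of_norm_bounded (hSn.mul_of_nonneg hn (fun _ => norm_nonneg _) fun _ => norm_nonneg _)
      fun p => ContinuousLinearMap.le_opNorm _ _
  have h1 := ha.hasSum.prod_fiberwise fun j => hH.mapL (w ^ j • Sc j)
  have h2 : HasSum (fun j => (w ^ j • Sc j) H) (S H) :=
    hS.mapL (ContinuousLinearMap.apply ℂ Y H)
  have h3 := ha.hasSum.sum_range_antidiagonal
  rw [h1.unique h2] at h3
  convert h3 using 2 with ℓ
  rw [Finset.smul_sum]
  refine Finset.sum_congr rfl fun j hj => ?_
  have : ℓ - j + j = ℓ := by have := Finset.mem_range.1 hj; omega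
  simp only [smul_apply, map_smul, smul_smul]
  rw [← pow_add, this]

theorem sum_inner_pick [CompleteSpace U] [CompleteSpace Y] {k : ℕ} (K s : Fin k → Fin k → ℂ)
    (V : Fin k → (U →L[ℂ] Y)) (y : Fin k → Y) :
    ∑ i, ∑ l, inner ℂ (y i)
        (K i l • y l - s i l • V i (ContinuousLinearMap.adjoint (V l) (y l))) =
      ∑ i, ∑ l, K i l * inner ℂ (y i) (y l) -
      ∑ i, ∑ l, s i l * inner ℂ (ContinuousLinearMap.adjoint (V i) (y i))
        (ContinuousLinearMap.adjoint (V l) (y l)) := by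
  simp only [← Finset.sum_sub_distrib]
  refine Finset.sum_congr rfl fun i _ => Finset.sum_congr rfl fun l _ => ?_
  rw [inner_sub_right, inner_smul_right, inner_smul_right, ContinuousLinearMap.adjoint_inner_left]

end Multiplier

theorem hasSum_re_and_im_eq_zero {r : ℕ → ℝ} {s : ℂ} (h : HasSum (fun j => (r j : ℂ)) s) :
    HasSum r s.re ∧ s.im = 0 := by
  have h1 := h.mapL Complex.reCLM
  have h2 := h.mapL Complex.imCLM
  simp only [Complex.reCLM_apply, Complex.imCLM_apply, Complex.ofReal_re, Complex.ofReal_im]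
    at h1 h2
  exact ⟨h1, h2.unique hasSum_zero⟩

theorem tsum_pow_mul_conj_pow {z w : ℂ} (hz : z ∈ ball (0 : ℂ) 1) (hw : w ∈ ball (0 : ℂ) 1) :
    ∑' j : ℕ, ((1 : ℝ) : ℂ) * z ^ j * (starRingEnd ℂ w) ^ j = (1 - z * starRingEnd ℂ w)⁻¹ := by
  have h1 := mem_ball_zero_iff.1 hz
  have h2 := mem_ball_zero_iff.1 hw
  simp only [Complex.ofReal_one, one_mul, ← mul_pow]
  refine tsum_geometric_of_norm_lt_one ?_
  rw [norm_mul, RCLike.norm_conj]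
  nlinarith [norm_nonneg z, norm_nonneg w]

theorem hasSum_szego_form {X : Type*} [NormedAddCommGroup X] [InnerProductSpace ℂ X]
    {k : ℕ} {z : Fin k → ℂ} (hz : ∀ i, z i ∈ ball (0 : ℂ) 1)
    (u : Fin k → X) :
    HasSum (fun j => ((‖∑ i, (starRingEnd ℂ (z i)) ^ j • u i‖ ^ 2 : ℝ) : ℂ))
      (∑ i, ∑ l, (1 - z i * starRingEnd ℂ (z l))⁻¹ * inner ℂ (u i) (u l)) := by
  have h := hasSum_kernel_form (a := fun _ => 1)
    (fun r h0 h1 => by simpa using summable_geometric_of_lt_one h0 h1) hz u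
  simpa only [one_mul, tsum_pow_mul_conj_pow (hz _) (hz _)] using h

theorem IsWeightSeq.hasSum_form {β : ℕ → ℝ} (hβ : IsWeightSeq β) {X : Type*}
    [NormedAddCommGroup X] [InnerProductSpace ℂ X] {k : ℕ} {z : Fin k → ℂ}
    (hz : ∀ i, z i ∈ ball (0 : ℂ) 1) (y : Fin k → X) :
    HasSum (fun j => (((β j)⁻¹ * ‖∑ i, (starRingEnd ℂ (z i)) ^ j • y i‖ ^ 2 : ℝ) : ℂ))
      (∑ i, ∑ l, (∑' j, (((β j)⁻¹ : ℝ) : ℂ) * z i ^ j * (starRingEnd ℂ (z l)) ^ j) *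
        inner ℂ (y i) (y l)) :=
  hasSum_kernel_form (a := fun j => (β j)⁻¹) (fun r h0 h1 => by
    refine (hβ.summable_inv_mul_pow h0 h1).congr fun j => ?_
    rw [Real.norm_of_nonneg (inv_nonneg.2 (hβ.1 j).le)]) hz y

section Pick

variable {U Y : Type*} [NormedAddCommGroup U] [InnerProductSpace ℂ U] [CompleteSpace U]
  [NormedAddCommGroup Y] [InnerProductSpace ℂ Y] [CompleteSpace Y]

theorem pick_form_im_eq_zero {β : ℕ → ℝ} (hβ : IsWeightSeq β) {k : ℕ} {z : Fin k → ℂ}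
    (hz : ∀ i, z i ∈ ball (0 : ℂ) 1) (V : Fin k → (U →L[ℂ] Y)) (y : Fin k → Y) :
    (∑ i, ∑ l, inner (𝕜 := ℂ) (y i)
            ((∑' j, (((β j)⁻¹ : ℝ) : ℂ) * (z i) ^ j * (starRingEnd ℂ (z l)) ^ j) • y l
              - (1 - z i * starRingEnd ℂ (z l))⁻¹ •
                  V i (ContinuousLinearMap.adjoint (V l) (y l)))).im = 0 := by
  rw [sum_inner_pick, Complex.sub_im, (hasSum_re_and_im_eq_zero (hβ.hasSum_form hz y)).2,
    (hasSum_re_and_im_eq_zero (hasSum_szego_form hz _)).2, sub_zero]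

theorem IsContractiveMultiplier.pick_form_nonneg {β : ℕ → ℝ} (hβ : IsWeightSeq β)
    (hmono : ∀ j, β (j + 1) ≤ β j) {k : ℕ} {z : Fin k → ℂ} (hz : ∀ i, z i ∈ ball (0 : ℂ) 1)
    {V : Fin k → (U →L[ℂ] Y)} {Sc : ℕ → (U →L[ℂ] Y)} (hSc : IsContractiveMultiplier β Sc)
    (hV : ∀ i, HasSum (fun j => z i ^ j • Sc j) (V i)) (y : Fin k → Y) :
    0 ≤ (∑ i, ∑ l, inner (𝕜 := ℂ) (y i)
            ((∑' j, (((β j)⁻¹ : ℝ) : ℂ) * (z i) ^ j * (starRingEnd ℂ (z l)) ^ j) • y l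
              - (1 - z i * starRingEnd ℂ (z l))⁻¹ •
                  V i (ContinuousLinearMap.adjoint (V l) (y l)))).re := by
  rw [sum_inner_pick, Complex.sub_re]
  let v : Fin k → U := fun i => ContinuousLinearMap.adjoint (V i) (y i)
  let h : ℕ → U := fun n => ∑ i, (starRingEnd ℂ (z i)) ^ n • v i
  let c : ℕ → Y := fun n => ∑ i, (starRingEnd ℂ (z i)) ^ n • y i
  have hN := hasSum_szego_form hz v
  have hF := (hasSum_re_and_im_eq_zero (hβ.hasSum_form hz y)).1
  let N := ∑ i, ∑ l, (1 - z i * starRingEnd ℂ (z l))⁻¹ * inner ℂ (v i) (v l)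
  have hNre := (hasSum_re_and_im_eq_zero hN).1
  have hbound : ∀ n, ‖h n‖ ≤ ∑ i, ‖v i‖ := fun n => by
    refine (norm_sum_le _ _).trans (Finset.sum_le_sum fun i _ => ?_)
    rw [norm_smul, norm_pow, RCLike.norm_conj]
    exact mul_le_of_le_one_left (norm_nonneg _)
      (pow_le_one₀ (norm_nonneg _) (mem_ball_zero_iff.1 (hz i)).le)
  have hsum : ∀ i, Summable fun n => ‖z i ^ n • h n‖ := fun i => by
    refine Summable.of_nonneg_of_le (fun _ => norm_nonneg _) (fun n => ?_)
      ((summable_geometric_of_lt_one (norm_nonneg (z i))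
        (mem_ball_zero_iff.1 (hz i))).mul_right (∑ i, ‖v i‖))
    rw [norm_smul, norm_pow]
    gcongr
    exact hbound n
  have hH : ∀ i, HasSum (fun n => z i ^ n • h n) (∑' n, z i ^ n • h n) := fun i =>
    (hsum i).of_norm.hasSum
  let g : ℕ → Y := fun ℓ => ∑ j ∈ Finset.range (ℓ + 1), Sc j (h (ℓ - j))
  have hM1 : HasSum (fun ℓ => inner ℂ (c ℓ) (g ℓ)) (∑ i, inner ℂ (v i) (∑' n, z i ^ n • h n)) := by
    have hc' : ∀ ℓ, inner ℂ (c ℓ) (g ℓ) = ∑ i, inner ℂ (y i) (z i ^ ℓ • g ℓ) := fun ℓ =>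
      inner_sum_conj_pow_smul z y (g ℓ) ℓ
    have hv' : ∀ i, inner ℂ (v i) (∑' n, z i ^ n • h n) =
        inner ℂ (y i) (V i (∑' n, z i ^ n • h n)) := fun i =>
      ContinuousLinearMap.adjoint_inner_left _ _ _
    simp only [hc', hv']
    exact hasSum_sum fun i _ => (hasSum_pow_smul_sum_range (hV i)
      (hSc.summable_norm hβ hmono (hz i)) (hH i) (hsum i)).mapL (innerSL ℂ (y i))
  have hM2 : HasSum (fun n => inner ℂ (h n) (h n)) (∑ i, inner ℂ (v i) (∑' n, z i ^ n • h n)) := by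
    have hh' : ∀ n, inner ℂ (h n) (h n) = ∑ i, inner ℂ (v i) (z i ^ n • h n) := fun n =>
      inner_sum_conj_pow_smul z v (h n) n
    simp only [hh']
    exact hasSum_sum fun i _ => (hH i).mapL (innerSL ℂ (v i))
  have hM : HasSum (fun ℓ => (inner ℂ (c ℓ) (g ℓ)).re) N.re := by
    have h1 : HasSum (fun n => inner ℂ (h n) (h n)) N := by
      simp only [inner_self_eq_norm_sq_to_K (𝕜 := ℂ)]
      simpa using hN
    rw [hM2.unique h1] at hM1
    exact hM1.mapL Complex.reCLM
  obtain ⟨hg1, hg2⟩ := hSc h hNre.summable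
  rw [hNre.tsum_eq] at hg2
  have hle := hasSum_le (fun ℓ => ?_) (hM.mul_left 2) (hg1.hasSum.add hF)
  · linarith
  · have hβℓ := hβ.1 ℓ
    have h1 : (inner ℂ (c ℓ) (g ℓ)).re ≤ ‖c ℓ‖ * ‖g ℓ‖ :=
      re_inner_le_norm (𝕜 := ℂ) _ _
    have h2 : 0 ≤ β ℓ * (‖g ℓ‖ - (β ℓ)⁻¹ * ‖c ℓ‖) ^ 2 := by positivity
    have h3 : β ℓ * (‖g ℓ‖ - (β ℓ)⁻¹ * ‖c ℓ‖) ^ 2 =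
        β ℓ * ‖g ℓ‖ ^ 2 + (β ℓ)⁻¹ * ‖c ℓ‖ ^ 2 - 2 * (‖c ℓ‖ * ‖g ℓ‖) := by
      field_simp
      ring
    linarith

end Pick

/-- The increments `β_j⁻¹ - β_{j-1}⁻¹`, which are the Taylor coefficients of the quotient of the
kernel of `H²_β` by the Szegő kernel. -/
def weightIncr (β : ℕ → ℝ) : ℕ → ℝ
  | 0 => (β 0)⁻¹
  | n + 1 => (β (n + 1))⁻¹ - (β n)⁻¹

theorem IsWeightSeq.weightIncr_nonneg {β : ℕ → ℝ} (hβ : IsWeightSeq β)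
    (hmono : ∀ j, β (j + 1) ≤ β j) : ∀ j, 0 ≤ weightIncr β j
  | 0 => inv_nonneg.2 (hβ.1 0).le
  | j + 1 => sub_nonneg.2 (inv_anti₀ (hβ.1 (j + 1)) (hmono j))

theorem sum_weightIncr (β : ℕ → ℝ) (n : ℕ) :
    ∑ i ∈ Finset.range (n + 1), weightIncr β i = (β n)⁻¹ := by
  induction n with
  | zero => simp [weightIncr]
  | succ n ih => rw [Finset.sum_range_succ, ih, weightIncr]; ring

theorem IsWeightSeq.weightIncr_le {β : ℕ → ℝ} (hβ : IsWeightSeq β) : ∀ j,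
    weightIncr β j ≤ (β j)⁻¹
  | 0 => le_rfl
  | j + 1 => sub_le_self _ (inv_nonneg.2 (hβ.1 j).le)

theorem IsWeightSeq.summable_norm_weightIncr {β : ℕ → ℝ} (hβ : IsWeightSeq β)
    (hmono : ∀ j, β (j + 1) ≤ β j) {r : ℝ} (hr0 : 0 ≤ r) (hr1 : r < 1) :
    Summable fun j => ‖weightIncr β j‖ * r ^ j := by
  refine Summable.of_nonneg_of_le (fun j => by positivity) (fun j => ?_)
    (hβ.summable_inv_mul_pow hr0 hr1)
  rw [Real.norm_of_nonneg (hβ.weightIncr_nonneg hmono j)]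
  gcongr
  exact hβ.weightIncr_le j

theorem IsWeightSeq.summable_sqrt_weightIncr {β : ℕ → ℝ} (hβ : IsWeightSeq β)
    (hmono : ∀ j, β (j + 1) ≤ β j) {r : ℝ} (hr0 : 0 ≤ r) (hr1 : r < 1) :
    Summable fun j => √(weightIncr β j) * r ^ j := by
  refine Summable.of_nonneg_of_le (fun j => by positivity) (fun j => ?_)
    (hβ.summable_inv_mul_pow hr0 hr1)
  gcongr
  have h1 : 1 ≤ (β j)⁻¹ := (one_le_inv₀ (hβ.1 j)).2 (hβ.le_one hmono j)
  refine Real.sqrt_le_iff.2 ⟨by positivity, (hβ.weightIncr_le j).trans ?_⟩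
  nlinarith

theorem IsWeightSeq.tsum_weightIncr {β : ℕ → ℝ} (hβ : IsWeightSeq β)
    (hmono : ∀ j, β (j + 1) ≤ β j) {z w : ℂ} (hz : z ∈ ball (0 : ℂ) 1)
    (hw : w ∈ ball (0 : ℂ) 1) :
    ∑' j, (weightIncr β j : ℂ) * z ^ j * w ^ j =
      (1 - z * w) * ∑' j, (((β j)⁻¹ : ℝ) : ℂ) * z ^ j * w ^ j := by
  have h1 := mem_ball_zero_iff.1 hz
  have h2 := mem_ball_zero_iff.1 hw
  have hr : ‖z‖ * ‖w‖ < 1 := by nlinarith [norm_nonneg z, norm_nonneg w]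
  have hs : Summable fun j => (((β j)⁻¹ : ℝ) : ℂ) * z ^ j * w ^ j := by
    refine Summable.of_norm_bounded (hβ.summable_inv_mul_pow (by positivity) hr)
      fun j => le_of_eq ?_
    rw [norm_mul, norm_mul, Complex.norm_real, Real.norm_of_nonneg (inv_nonneg.2 (hβ.1 j).le),
      norm_pow, norm_pow, mul_pow, mul_assoc]
  have hs' : Summable fun j => (weightIncr β j : ℂ) * z ^ j * w ^ j := by
    refine Summable.of_norm_bounded (hβ.summable_norm_weightIncr hmono (by positivity) hr)
      fun j => le_of_eq ?_
    rw [norm_mul, norm_mul, Complex.norm_real, norm_pow, norm_pow, mul_pow, mul_assoc]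
  have hshift := (summable_nat_add_iff 1).2 hs
  have hterm : ∀ j, (weightIncr β (j + 1) : ℂ) * z ^ (j + 1) * w ^ (j + 1) =
      (((β (j + 1))⁻¹ : ℝ) : ℂ) * z ^ (j + 1) * w ^ (j + 1) -
        z * w * ((((β j)⁻¹ : ℝ) : ℂ) * z ^ j * w ^ j) := fun j => by
    rw [weightIncr]
    push_cast
    ring
  rw [hs'.tsum_eq_zero_add]
  simp only [hterm]
  rw [hshift.tsum_sub (hs.mul_left _), tsum_mul_left]
  have h0 := hs.tsum_eq_zero_add
  simp only [weightIncr, pow_zero, mul_one] at h0 ⊢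
  linear_combination -h0

section Colligation

variable {K U E : Type*} [NormedAddCommGroup K] [NormedSpace ℂ K]
  [NormedAddCommGroup U] [NormedSpace ℂ U] [NormedAddCommGroup E] [NormedSpace ℂ E]

/-- The state trajectory of the linear system `x (n + 1) = A (x n) + B (h n)`, `x 0 = 0`. -/
def systemState (A : K →L[ℂ] K) (B : U →L[ℂ] K) (h : ℕ → U) : ℕ → K
  | 0 => 0
  | n + 1 => A (systemState A B h n) + B (h n)

/-- The Taylor coefficients of the transfer function `D + z C (1 - z A)⁻¹ B`. -/
def transferCoeff (A : K →L[ℂ] K) (B : U →L[ℂ] K) (C : K →L[ℂ] E) (D : U →L[ℂ] E) :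
    ℕ → (U →L[ℂ] E)
  | 0 => D
  | n + 1 => C ∘L (A ^ n) ∘L B

theorem systemState_eq_sum (A : K →L[ℂ] K) (B : U →L[ℂ] K) (h : ℕ → U) (n : ℕ) :
    systemState A B h n = ∑ j ∈ Finset.range n, (A ^ j) (B (h (n - (j + 1)))) := by
  induction n with
  | zero => simp [systemState]
  | succ n ih =>
    rw [systemState, ih, Finset.sum_range_succ', map_sum]
    congr 1
    refine Finset.sum_congr rfl fun j _ => ?_
    rw [pow_succ', Nat.add_sub_add_right]
    rfl

theorem sum_transferCoeff (A : K →L[ℂ] K) (B : U →L[ℂ] K) (C : K →L[ℂ] E) (D : U →L[ℂ] E)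
    (h : ℕ → U) (n : ℕ) :
    ∑ j ∈ Finset.range (n + 1), transferCoeff A B C D j (h (n - j)) =
      C (systemState A B h n) + D (h n) := by
  rw [Finset.sum_range_succ', systemState_eq_sum, map_sum]
  rfl

theorem sum_norm_sq_output_le {A : K →L[ℂ] K} {B : U →L[ℂ] K} {C : K →L[ℂ] E} {D : U →L[ℂ] E}
    (hc : ∀ p u, ‖A p + B u‖ ^ 2 + ‖C p + D u‖ ^ 2 ≤ ‖p‖ ^ 2 + ‖u‖ ^ 2) (h : ℕ → U) (N : ℕ) :
    ∑ n ∈ Finset.range N, ‖C (systemState A B h n) + D (h n)‖ ^ 2 + ‖systemState A B h N‖ ^ 2 ≤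
      ∑ n ∈ Finset.range N, ‖h n‖ ^ 2 := by
  induction N with
  | zero => simp [systemState]
  | succ N ih =>
    rw [Finset.sum_range_succ, Finset.sum_range_succ, systemState]
    linarith [hc (systemState A B h N) (h N)]

end Colligation

theorem sum_range_sum_range_comm {M : Type*} [AddCommMonoid M] (f : ℕ → ℕ → ℕ → M) (ℓ : ℕ) :
    ∑ j ∈ Finset.range (ℓ + 1), ∑ i ∈ Finset.range (j + 1), f i (j - i) (ℓ - j) =
      ∑ i ∈ Finset.range (ℓ + 1), ∑ m ∈ Finset.range (ℓ - i + 1), f i m (ℓ - i - m) := by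
  rw [Finset.sum_sigma', Finset.sum_sigma']
  refine Finset.sum_bij' (fun x _ => ⟨x.2, x.1 - x.2⟩) (fun x _ => ⟨x.1 + x.2, x.1⟩)
    ?_ ?_ ?_ ?_ ?_
  · rintro ⟨j, i⟩ hx
    simp only [Finset.mem_sigma, Finset.mem_range] at hx ⊢
    omega
  · rintro ⟨i, m⟩ hx
    simp only [Finset.mem_sigma, Finset.mem_range] at hx ⊢
    omega
  · rintro ⟨j, i⟩ hx
    simp only [Finset.mem_sigma, Finset.mem_range] at hx
    simp only [Sigma.mk.injEq, heq_eq_eq, and_true]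
    omega
  · rintro ⟨i, m⟩ hx
    simp
  · rintro ⟨j, i⟩ hx
    simp only [Finset.mem_sigma, Finset.mem_range] at hx
    have : ℓ - i - (j - i) = ℓ - j := by omega
    simp only [this]

theorem lp_hasSum_norm_sq {Y : Type*} [NormedAddCommGroup Y] (f : lp (fun _ : ℕ => Y) 2) :
    HasSum (fun i => ‖f i‖ ^ 2) (‖f‖ ^ 2) := by
  have h := lp.hasSum_norm (p := 2) (by norm_num) f
  simpa using h

theorem norm_sq_sum_sqrt_weightIncr_le {Y : Type*} [NormedAddCommGroup Y] [NormedSpace ℂ Y]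
    {β : ℕ → ℝ} (hβ : IsWeightSeq β) (hmono : ∀ j, β (j + 1) ≤ β j) (v : ℕ → Y) (ℓ : ℕ) :
    β ℓ * ‖∑ i ∈ Finset.range (ℓ + 1), (√(weightIncr β i) : ℂ) • v i‖ ^ 2 ≤
      ∑ i ∈ Finset.range (ℓ + 1), ‖v i‖ ^ 2 := by
  have hβℓ := hβ.1 ℓ
  have h1 : ‖∑ i ∈ Finset.range (ℓ + 1), (√(weightIncr β i) : ℂ) • v i‖ ≤
      ∑ i ∈ Finset.range (ℓ + 1), √(weightIncr β i) * ‖v i‖ := by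
    refine (norm_sum_le _ _).trans_eq (Finset.sum_congr rfl fun i _ => ?_)
    rw [norm_smul, Complex.norm_real, Real.norm_of_nonneg (Real.sqrt_nonneg _)]
  have h2 := Finset.sum_mul_sq_le_sq_mul_sq (Finset.range (ℓ + 1))
    (fun i => √(weightIncr β i)) (fun i => ‖v i‖)
  simp only [Real.sq_sqrt (hβ.weightIncr_nonneg hmono _), sum_weightIncr] at h2
  calc _ ≤ β ℓ * ((β ℓ)⁻¹ * ∑ i ∈ Finset.range (ℓ + 1), ‖v i‖ ^ 2) := by
        gcongr
        exact (pow_le_pow_left₀ (norm_nonneg _) h1 2).trans h2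
    _ = _ := mul_inv_cancel_left₀ hβℓ.ne' _

theorem hasSum_antidiagonal_norm_sq {Y : Type*} [NormedAddCommGroup Y]
    {o : ℕ → lp (fun _ : ℕ => Y) 2} (ho : Summable fun n => ‖o n‖ ^ 2) :
    HasSum (fun ℓ => ∑ i ∈ Finset.range (ℓ + 1), ‖o (ℓ - i) i‖ ^ 2) (∑' n, ‖o n‖ ^ 2) := by
  have hs : Summable fun p : ℕ × ℕ => ‖o p.1 p.2‖ ^ 2 := by
    refine (summable_prod_of_nonneg fun p => by positivity).2
      ⟨fun n => (lp_hasSum_norm_sq (o n)).summable, ?_⟩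
    simpa only [(lp_hasSum_norm_sq (o _)).tsum_eq] using ho
  have h1 := hs.hasSum.prod_fiberwise fun n => lp_hasSum_norm_sq (o n)
  have h2 := hs.hasSum
  rw [h1.unique ho.hasSum] at h2
  exact ((Equiv.prodComm ℕ ℕ).hasSum_iff.2 h2).sum_range_antidiagonal

/-- The Taylor coefficients of the product of the row `(√(weightIncr β j) z ^ j)_j` with the
`ℓ²`-valued power series `∑ z ^ j F_j`. -/
def rowMulCoeff {U Y : Type*} [NormedAddCommGroup U] [NormedSpace ℂ U]
    [NormedAddCommGroup Y] [NormedSpace ℂ Y] (β : ℕ → ℝ)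
    (F : ℕ → (U →L[ℂ] lp (fun _ : ℕ => Y) 2)) (ℓ : ℕ) : U →L[ℂ] Y :=
  ∑ i ∈ Finset.range (ℓ + 1),
    (√(weightIncr β i) : ℂ) • (lp.evalCLM ℂ (fun _ : ℕ => Y) 2 i ∘L F (ℓ - i))

theorem rowMulCoeff_apply {U Y : Type*} [NormedAddCommGroup U] [NormedSpace ℂ U]
    [NormedAddCommGroup Y] [NormedSpace ℂ Y] (β : ℕ → ℝ)
    (F : ℕ → (U →L[ℂ] lp (fun _ : ℕ => Y) 2)) (ℓ : ℕ) (u : U) :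
    rowMulCoeff β F ℓ u =
      ∑ i ∈ Finset.range (ℓ + 1), (√(weightIncr β i) : ℂ) • (F (ℓ - i) u) i := by
  simp only [rowMulCoeff, sum_apply, smul_apply, ContinuousLinearMap.comp_apply]
  rfl

theorem sum_rowMulCoeff {U Y : Type*} [NormedAddCommGroup U] [NormedSpace ℂ U]
    [NormedAddCommGroup Y] [NormedSpace ℂ Y] (β : ℕ → ℝ)
    (F : ℕ → (U →L[ℂ] lp (fun _ : ℕ => Y) 2)) (h : ℕ → U) (ℓ : ℕ) :
    ∑ j ∈ Finset.range (ℓ + 1), rowMulCoeff β F j (h (ℓ - j)) =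
      ∑ i ∈ Finset.range (ℓ + 1), (√(weightIncr β i) : ℂ) •
        (∑ m ∈ Finset.range (ℓ - i + 1), F m (h (ℓ - i - m))) i := by
  simp only [rowMulCoeff_apply]
  rw [sum_range_sum_range_comm fun i m n => (√(weightIncr β i) : ℂ) • (F m (h n)) i]
  refine Finset.sum_congr rfl fun i _ => ?_
  rw [lp.coeFn_sum, Finset.sum_apply, Finset.smul_sum]

theorem isContractiveMultiplier_rowMulCoeff {U Y K : Type*}
    [NormedAddCommGroup U] [InnerProductSpace ℂ U] [NormedAddCommGroup Y] [InnerProductSpace ℂ Y]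
    [NormedAddCommGroup K] [NormedSpace ℂ K]
    {β : ℕ → ℝ} (hβ : IsWeightSeq β) (hmono : ∀ j, β (j + 1) ≤ β j)
    {A : K →L[ℂ] K} {B : U →L[ℂ] K} {C : K →L[ℂ] lp (fun _ : ℕ => Y) 2}
    {D : U →L[ℂ] lp (fun _ : ℕ => Y) 2}
    (hc : ∀ p u, ‖A p + B u‖ ^ 2 + ‖C p + D u‖ ^ 2 ≤ ‖p‖ ^ 2 + ‖u‖ ^ 2) :
    IsContractiveMultiplier β (rowMulCoeff β (transferCoeff A B C D)) := by
  intro h hh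
  simp only [sum_rowMulCoeff, sum_transferCoeff]
  let o : ℕ → lp (fun _ : ℕ => Y) 2 := fun n => C (systemState A B h n) + D (h n)
  have hpart : ∀ N, ∑ n ∈ Finset.range N, ‖o n‖ ^ 2 ≤ ∑' n, ‖h n‖ ^ 2 := fun N =>
    ((le_add_of_nonneg_right (by positivity)).trans (sum_norm_sq_output_le hc h N)).trans
      (hh.sum_le_tsum _ fun _ _ => by positivity)
  have ho : Summable fun n => ‖o n‖ ^ 2 :=
    summable_of_sum_range_le (fun _ => by positivity) hpart
  have hle := ho.tsum_le_of_sum_range_le hpart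
  have ha := hasSum_antidiagonal_norm_sq ho
  have hb : ∀ ℓ, β ℓ * ‖∑ i ∈ Finset.range (ℓ + 1),
      (√(weightIncr β i) : ℂ) • (o (ℓ - i)) i‖ ^ 2 ≤
      ∑ i ∈ Finset.range (ℓ + 1), ‖o (ℓ - i) i‖ ^ 2 := fun ℓ =>
    norm_sq_sum_sqrt_weightIncr_le hβ hmono (fun i => o (ℓ - i) i) ℓ
  have hs := Summable.of_nonneg_of_le
    (fun ℓ => by have := hβ.1 ℓ; positivity) hb ha.summable
  exact ⟨hs, (hasSum_le hb hs.hasSum ha).trans hle⟩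

section Transfer

variable {K U E : Type*} [NormedAddCommGroup K] [InnerProductSpace ℂ K]
  [NormedAddCommGroup U] [InnerProductSpace ℂ U] [NormedAddCommGroup E] [InnerProductSpace ℂ E]
  {A : K →L[ℂ] K} {B : U →L[ℂ] K} {C : K →L[ℂ] E} {D : U →L[ℂ] E}

theorem transferCoeff_apply (n : ℕ) (u : U) : transferCoeff A B C D n u =
    C (systemState A B (Pi.single 0 u) n) + D ((Pi.single 0 u : ℕ → U) n) := by
  rw [← sum_transferCoeff, sum_range_apply_single]

theorem sum_norm_sq_transferCoeff_le
    (hc : ∀ p u, ‖A p + B u‖ ^ 2 + ‖C p + D u‖ ^ 2 ≤ ‖p‖ ^ 2 + ‖u‖ ^ 2) (u : U) (N : ℕ) :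
    ∑ n ∈ Finset.range N, ‖transferCoeff A B C D n u‖ ^ 2 +
      ‖systemState A B (Pi.single 0 u) N‖ ^ 2 ≤ ‖u‖ ^ 2 := by
  simp only [transferCoeff_apply]
  refine (sum_norm_sq_output_le hc (Pi.single 0 u) N).trans ?_
  have h := hasSum_norm_sq_single u
  exact (h.summable.sum_le_tsum _ fun _ _ => by positivity).trans_eq h.tsum_eq

theorem norm_transferCoeff_apply_le
    (hc : ∀ p u, ‖A p + B u‖ ^ 2 + ‖C p + D u‖ ^ 2 ≤ ‖p‖ ^ 2 + ‖u‖ ^ 2) (u : U) (n : ℕ) :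
    ‖transferCoeff A B C D n u‖ ≤ ‖u‖ := by
  refine le_of_sq_le_sq ?_ (norm_nonneg _)
  have h := sum_norm_sq_transferCoeff_le hc u (n + 1)
  have h1 := Finset.single_le_sum (f := fun n => ‖transferCoeff A B C D n u‖ ^ 2)
    (fun _ _ => by positivity) (Finset.self_mem_range_succ n)
  have h2 := sq_nonneg ‖systemState A B (Pi.single 0 u) (n + 1)‖
  linarith

theorem hasSum_inner_transferCoeff
    (hc : ∀ p u, ‖A p + B u‖ ^ 2 + ‖C p + D u‖ ^ 2 ≤ ‖p‖ ^ 2 + ‖u‖ ^ 2)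
    {z : ℂ} (hz : z ∈ ball (0 : ℂ) 1) {q : K} {r : U} {g : E}
    (hrel : ∀ p u, z * inner ℂ q (A p + B u) + inner ℂ g (C p + D u) =
      inner ℂ q p + inner ℂ r u) (u : U) :
    HasSum (fun n => z ^ n * inner ℂ g (transferCoeff A B C D n u)) (inner ℂ r u) := by
  have hz1 := mem_ball_zero_iff.1 hz
  have hs : Summable fun n => z ^ n * inner ℂ g (transferCoeff A B C D n u) := by
    refine Summable.of_norm_bounded
      ((summable_geometric_of_lt_one (norm_nonneg z) hz1).mul_right (‖g‖ * ‖u‖)) fun n => ?_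
    rw [norm_mul, norm_pow]
    gcongr
    exact (norm_inner_le_norm _ _).trans
      (mul_le_mul_of_nonneg_left (norm_transferCoeff_apply_le hc u n) (norm_nonneg _))
  have hpart : ∀ N, ∑ n ∈ Finset.range (N + 1), z ^ n * inner ℂ g (transferCoeff A B C D n u) =
      inner ℂ r u - z ^ (N + 1) * inner ℂ q (systemState A B (Pi.single 0 u) (N + 1)) := by
    intro N
    induction N with
    | zero =>
      have h := hrel 0 u
      simp only [map_zero, zero_add, inner_zero_right] at h
      simp only [zero_add, Finset.range_one, Finset.sum_singleton, pow_zero, one_mul, pow_one,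
        transferCoeff, systemState, Pi.single_eq_same, map_zero]
      linear_combination h
    | succ N ih =>
      have hzero : (Pi.single 0 u : ℕ → U) (N + 1) = 0 :=
        Pi.single_eq_of_ne (Nat.succ_ne_zero N) u
      have hstate : systemState A B (Pi.single 0 u) (N + 1 + 1) =
          A (systemState A B (Pi.single 0 u) (N + 1)) + B 0 := by
        rw [systemState, hzero]
      rw [Finset.sum_range_succ, ih, transferCoeff_apply, hzero, hstate]
      have h := hrel (systemState A B (Pi.single 0 u) (N + 1)) 0
      rw [inner_zero_right] at h
      linear_combination z ^ (N + 1) * h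
  have hlim : Tendsto (fun N => z ^ N * inner ℂ q (systemState A B (Pi.single 0 u) N)) atTop
      (nhds 0) := by
    refine squeeze_zero_norm (a := fun N => ‖z‖ ^ N * (‖q‖ * ‖u‖)) (fun N => ?_) ?_
    · rw [norm_mul, norm_pow]
      gcongr
      refine (norm_inner_le_norm _ _).trans (mul_le_mul_of_nonneg_left ?_ (norm_nonneg _))
      refine le_of_sq_le_sq ?_ (norm_nonneg _)
      exact (le_add_of_nonneg_left (Finset.sum_nonneg fun _ _ => by positivity)).trans
        (sum_norm_sq_transferCoeff_le hc u N)
    · simpa using (tendsto_pow_atTop_nhds_zero_of_lt_one (norm_nonneg z) hz1).mul_const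
        (‖q‖ * ‖u‖)
  have h1 := (tendsto_add_atTop_iff_nat 1).2 hs.hasSum.tendsto_sum_nat
  simp only [hpart] at h1
  have h2 := ((tendsto_add_atTop_iff_nat 1).2 hlim).const_sub (inner ℂ r u)
  rw [sub_zero] at h2
  rw [← tendsto_nhds_unique h1 h2]
  exact hs.hasSum

end Transfer

theorem hasSum_inner_rowMulCoeff {U Y : Type*} [NormedAddCommGroup U] [NormedSpace ℂ U]
    [NormedAddCommGroup Y] [InnerProductSpace ℂ Y]
    {β : ℕ → ℝ} (hβ : IsWeightSeq β) (hmono : ∀ j, β (j + 1) ≤ β j)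
    {F : ℕ → (U →L[ℂ] lp (fun _ : ℕ => Y) 2)} (hF : ∀ n u, ‖F n u‖ ≤ ‖u‖)
    {z : ℂ} (hz : z ∈ ball (0 : ℂ) 1) {g : lp (fun _ : ℕ => Y) 2} {y : Y}
    (hg : ∀ j, g j = ((√(weightIncr β j) : ℂ) * (starRingEnd ℂ z) ^ j) • y) {u : U} {s : ℂ}
    (hs : HasSum (fun n => z ^ n * inner ℂ g (F n u)) s) :
    HasSum (fun ℓ => inner ℂ y (z ^ ℓ • rowMulCoeff β F ℓ u)) s := by
  have hz1 := mem_ball_zero_iff.1 hz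
  let a : ℕ × ℕ → ℂ := fun p =>
    ((√(weightIncr β p.1) : ℂ) * z ^ p.1) * (z ^ p.2 * inner ℂ y (F p.2 u p.1))
  have ha : Summable a := by
    refine Summable.of_norm_bounded
      ((hβ.summable_sqrt_weightIncr hmono (norm_nonneg z) hz1).mul_of_nonneg
        ((summable_geometric_of_lt_one (norm_nonneg z) hz1).mul_right (‖y‖ * ‖u‖))
        (fun _ => by positivity) fun _ => by positivity) fun p => ?_
    simp only [a]
    rw [norm_mul, norm_mul, norm_mul, Complex.norm_real, Real.norm_of_nonneg (Real.sqrt_nonneg _),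
      norm_pow, norm_pow]
    gcongr
    refine (norm_inner_le_norm _ _).trans (mul_le_mul_of_nonneg_left ?_ (norm_nonneg _))
    exact (lp.norm_apply_le_norm two_ne_zero _ _).trans (hF _ _)
  have hfiber : ∀ n, HasSum (fun j => a (j, n)) (z ^ n * inner ℂ g (F n u)) := fun n => by
    have hterm : ∀ j, a (j, n) = z ^ n * inner ℂ (g j) (F n u j) := fun j => by
      rw [hg, inner_smul_left, map_mul, map_pow, Complex.conj_conj, Complex.conj_ofReal]
      simp only [a]
      ring
    simp only [hterm]
    exact (lp.hasSum_inner (𝕜 := ℂ) g (F n u)).mul_left (z ^ n)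
  have h1 := ((Equiv.prodComm ℕ ℕ).hasSum_iff.2 ha.hasSum).prod_fiberwise hfiber
  have h2 := ha.hasSum.sum_range_antidiagonal
  rw [h1.unique hs] at h2
  have hterm : ∀ ℓ, inner ℂ y (z ^ ℓ • rowMulCoeff β F ℓ u) =
      ∑ j ∈ Finset.range (ℓ + 1), a (j, ℓ - j) := fun ℓ => by
    rw [rowMulCoeff_apply, Finset.smul_sum, inner_sum]
    refine Finset.sum_congr rfl fun j hj => ?_
    have hpow : z ^ ℓ = z ^ j * z ^ (ℓ - j) := by
      rw [← pow_add]
      congr 1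
      have := Finset.mem_range.1 hj
      omega
    simp only [a]
    rw [inner_smul_right, inner_smul_right, hpow]
    ring
  simpa only [hterm] using h2

theorem exists_norm_sq_eq_inner {H : Type*} [NormedAddCommGroup H] [InnerProductSpace ℂ H]
    [CompleteSpace H] (P : H →L[ℂ] H)
    (hP : ∀ x, 0 ≤ (inner ℂ x (P x)).re ∧ (inner ℂ x (P x)).im = 0) :
    ∃ Q : H →L[ℂ] H, ∀ x, ((‖Q x‖ ^ 2 : ℝ) : ℂ) = inner ℂ x (P x) := by
  have hpos : 0 ≤ P := by
    rw [ContinuousLinearMap.nonneg_iff_isPositive, ContinuousLinearMap.isPositive_iff_complex]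
    intro x
    obtain ⟨h1, h2⟩ := hP x
    rw [← inner_conj_symm, Complex.conj_eq_iff_im.2 h2]
    exact ⟨Complex.ext rfl h2.symm, h1⟩
  obtain ⟨Q, hQ⟩ := CStarAlgebra.nonneg_iff_eq_star_mul_self.1 hpos
  refine ⟨Q, fun x => ?_⟩
  rw [hQ, ContinuousLinearMap.star_eq_adjoint, mul_apply_eq_comp,
    ContinuousLinearMap.adjoint_inner_right, inner_self_eq_norm_sq_to_K]
  simp

/-- A positive semidefinite block operator matrix is the square of an operator. -/
theorem exists_norm_sq_eq_block_form {Y : Type*} [NormedAddCommGroup Y] [InnerProductSpace ℂ Y]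
    [CompleteSpace Y] {k : ℕ} (M : Fin k → Fin k → (Y →L[ℂ] Y))
    (hM : ∀ y : Fin k → Y, 0 ≤ (∑ i, ∑ l, inner ℂ (y i) (M i l (y l))).re ∧
      (∑ i, ∑ l, inner ℂ (y i) (M i l (y l))).im = 0) :
    ∃ Q : PiLp 2 (fun _ : Fin k => Y) →L[ℂ] PiLp 2 (fun _ : Fin k => Y),
      ∀ x, ((‖Q x‖ ^ 2 : ℝ) : ℂ) = ∑ i, ∑ l, inner ℂ (x i) (M i l (x l)) := by
  let π : Fin k → (PiLp 2 (fun _ : Fin k => Y) →L[ℂ] Y) := fun i =>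
    PiLp.proj 2 (fun _ : Fin k => Y) i
  let P : PiLp 2 (fun _ : Fin k => Y) →L[ℂ] PiLp 2 (fun _ : Fin k => Y) :=
    ∑ i, ∑ l, ContinuousLinearMap.adjoint (π i) ∘L M i l ∘L π l
  have hP : ∀ x, inner ℂ x (P x) = ∑ i, ∑ l, inner ℂ (x i) (M i l (x l)) := fun x => by
    simp only [P, sum_apply, inner_sum, ContinuousLinearMap.comp_apply,
      ContinuousLinearMap.adjoint_inner_right]
    rfl
  obtain ⟨Q, hQ⟩ := exists_norm_sq_eq_inner P fun x => by
    rw [hP]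
    exact hM x.ofLp
  exact ⟨Q, fun x => (hQ x).trans (hP x)⟩

/-- The map `y ↦ ∑ i, G(z i)* (y i)`, where `G(z) = (√(weightIncr β j) z ^ j)_j`. -/
theorem exists_row_adjoint {Y : Type*} [NormedAddCommGroup Y] [InnerProductSpace ℂ Y]
    {β : ℕ → ℝ} (hβ : IsWeightSeq β) (hmono : ∀ j, β (j + 1) ≤ β j)
    {k : ℕ} {z : Fin k → ℂ} (hz : ∀ i, z i ∈ ball (0 : ℂ) 1) :
    ∃ G : PiLp 2 (fun _ : Fin k => Y) →ₗ[ℂ] lp (fun _ : ℕ => Y) 2,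
      (∀ x j, G x j = (√(weightIncr β j) : ℂ) • ∑ i, (starRingEnd ℂ (z i)) ^ j • x i) ∧
      ∀ x, ((‖G x‖ ^ 2 : ℝ) : ℂ) = ∑ i, ∑ l, (1 - z i * starRingEnd ℂ (z l)) *
        (∑' j, (((β j)⁻¹ : ℝ) : ℂ) * z i ^ j * (starRingEnd ℂ (z l)) ^ j) *
          inner ℂ (x i) (x l) := by
  have hsum : ∀ x : PiLp 2 (fun _ : Fin k => Y), _ := fun x =>
    hasSum_kernel_form (fun r => hβ.summable_norm_weightIncr hmono) hz x.ofLp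
  have hnorm : ∀ (x : PiLp 2 (fun _ : Fin k => Y)) j,
      ‖(√(weightIncr β j) : ℂ) • ∑ i, (starRingEnd ℂ (z i)) ^ j • x i‖ ^ 2 =
      weightIncr β j * ‖∑ i, (starRingEnd ℂ (z i)) ^ j • x i‖ ^ 2 := fun x j => by
    rw [norm_smul, mul_pow, Complex.norm_real, Real.norm_of_nonneg (Real.sqrt_nonneg _),
      Real.sq_sqrt (hβ.weightIncr_nonneg hmono j)]
  have hmem : ∀ x : PiLp 2 (fun _ : Fin k => Y),
      Memℓp (fun j => (√(weightIncr β j) : ℂ) • ∑ i, (starRingEnd ℂ (z i)) ^ j • x i) 2 :=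
    fun x => by
      refine memℓp_gen ?_
      simp only [ENNReal.toReal_ofNat, Real.rpow_ofNat, hnorm]
      exact (hasSum_re_and_im_eq_zero (hsum x)).1.summable
  let G : PiLp 2 (fun _ : Fin k => Y) →ₗ[ℂ] lp (fun _ : ℕ => Y) 2 :=
    { toFun := fun x => ⟨_, hmem x⟩
      map_add' := fun x x' => by
        ext j
        change (_ : Y) = _ • _ + _ • _
        simp only [PiLp.add_apply, smul_add, Finset.sum_add_distrib]
      map_smul' := fun c x => by
        ext j
        simp only [PiLp.smul_apply, RingHom.id_apply, lp.coeFn_smul, Pi.smul_apply,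
          smul_comm _ c, ← Finset.smul_sum] }
  refine ⟨G, fun x j => rfl, fun x => ?_⟩
  have h1 : HasSum (fun j => ((weightIncr β j *
      ‖∑ i, (starRingEnd ℂ (z i)) ^ j • x i‖ ^ 2 : ℝ) : ℂ)) ((‖G x‖ ^ 2 : ℝ) : ℂ) := by
    refine Complex.hasSum_ofReal.2 ?_
    have h := lp_hasSum_norm_sq (G x)
    simp only [← hnorm]
    exact h
  rw [h1.unique (hsum x)]
  refine Finset.sum_congr rfl fun i _ => Finset.sum_congr rfl fun l _ => ?_
  rw [hβ.tsum_weightIncr hmono (hz i) (by simpa using hz l)]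

set_option maxHeartbeats 1000000 in
theorem exists_contractiveMultiplier_of_pick {U Y : Type*}
    [NormedAddCommGroup U] [InnerProductSpace ℂ U] [CompleteSpace U]
    [NormedAddCommGroup Y] [InnerProductSpace ℂ Y] [CompleteSpace Y]
    {β : ℕ → ℝ} (hβ : IsWeightSeq β) (hmono : ∀ j, β (j + 1) ≤ β j)
    {k : ℕ} {z : Fin k → ℂ} (hz : ∀ i, z i ∈ ball (0 : ℂ) 1) (V : Fin k → (U →L[ℂ] Y))
    (hP : ∀ y : Fin k → Y,
      0 ≤ (∑ i, ∑ l, inner (𝕜 := ℂ) (y i)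
            ((∑' j, (((β j)⁻¹ : ℝ) : ℂ) * (z i) ^ j * (starRingEnd ℂ (z l)) ^ j) • y l
              - (1 - z i * starRingEnd ℂ (z l))⁻¹ •
                  V i (ContinuousLinearMap.adjoint (V l) (y l)))).re ∧
      (∑ i, ∑ l, inner (𝕜 := ℂ) (y i)
            ((∑' j, (((β j)⁻¹ : ℝ) : ℂ) * (z i) ^ j * (starRingEnd ℂ (z l)) ^ j) • y l
              - (1 - z i * starRingEnd ℂ (z l))⁻¹ •
                  V i (ContinuousLinearMap.adjoint (V l) (y l)))).im = 0) :
    ∃ Sc : ℕ → (U →L[ℂ] Y), IsContractiveMultiplier β Sc ∧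
      ∀ i, HasSum (fun j => z i ^ j • Sc j) (V i) := by
  let κ : Fin k → Fin k → ℂ := fun i l =>
    ∑' j, (((β j)⁻¹ : ℝ) : ℂ) * (z i) ^ j * (starRingEnd ℂ (z l)) ^ j
  let σ : Fin k → Fin k → ℂ := fun i l => (1 - z i * starRingEnd ℂ (z l))⁻¹
  obtain ⟨Q, hQ⟩ := exists_norm_sq_eq_block_form
    (fun i l => κ i l • ContinuousLinearMap.id ℂ Y -
      σ i l • (V i ∘L ContinuousLinearMap.adjoint (V l))) hP
  have hQ' : ∀ x, ((‖Q x‖ ^ 2 : ℝ) : ℂ) = ∑ i, ∑ l, κ i l * inner ℂ (x i) (x l) -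
      ∑ i, ∑ l, σ i l * inner ℂ (ContinuousLinearMap.adjoint (V i) (x i))
        (ContinuousLinearMap.adjoint (V l) (x l)) := fun x =>
    (hQ x).trans (sum_inner_pick κ σ V x.ofLp)
  obtain ⟨G, hGapply, hGnorm⟩ := exists_row_adjoint (Y := Y) hβ hmono hz
  let Z : PiLp 2 (fun _ : Fin k => Y) →ₗ[ℂ] PiLp 2 (fun _ : Fin k => Y) :=
    { toFun := fun x => WithLp.toLp 2 fun i => starRingEnd ℂ (z i) • x i
      map_add' := fun x x' => by ext i; simp
      map_smul' := fun c x => by ext i; simp [smul_comm c] }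
  let R : PiLp 2 (fun _ : Fin k => Y) →ₗ[ℂ] U :=
    (∑ i, ContinuousLinearMap.adjoint (V i) ∘L PiLp.proj 2 (fun _ : Fin k => Y) i).toLinearMap
  have hR : ∀ x, R x = ∑ i, ContinuousLinearMap.adjoint (V i) (x i) := fun x => by
    simp [R]
  have hZ : ∀ x i, Z x i = starRingEnd ℂ (z i) • x i := fun x i => rfl
  have hne : ∀ i l, 1 - z i * starRingEnd ℂ (z l) ≠ 0 := fun i l h => by
    have h1 := mem_ball_zero_iff.1 (hz i)
    have h2 := mem_ball_zero_iff.1 (hz l)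
    have h3 : ‖z i * starRingEnd ℂ (z l)‖ = 1 := by rw [← sub_eq_zero.1 h, norm_one]
    rw [norm_mul, RCLike.norm_conj] at h3
    nlinarith [norm_nonneg (z i), norm_nonneg (z l)]
  have hisom : ∀ x, ‖Q.toLinearMap x‖ ^ 2 + ‖R x‖ ^ 2 =
      ‖(Q.toLinearMap ∘ₗ Z) x‖ ^ 2 + ‖G x‖ ^ 2 := fun x => by
    have hRn : ((‖R x‖ ^ 2 : ℝ) : ℂ) =
        ∑ i, ∑ l, inner ℂ (ContinuousLinearMap.adjoint (V i) (x i))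
          (ContinuousLinearMap.adjoint (V l) (x l)) := by
      have h := inner_self_eq_norm_sq_to_K (𝕜 := ℂ) (R x)
      rw [hR x, sum_inner] at h
      simp only [inner_sum] at h
      rw [h, hR x]
      simp
    apply Complex.ofReal_injective
    rw [Complex.ofReal_add, Complex.ofReal_add, hRn, hGnorm, LinearMap.comp_apply]
    refine (congrArg (· + _) (hQ' x)).trans (Eq.trans ?_ (congrArg (· + _) (hQ' (Z x))).symm)
    simp only [hZ, map_smul, inner_smul_left, inner_smul_right, Complex.conj_conj,
      ← Finset.sum_sub_distrib, ← Finset.sum_add_distrib]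
    refine Finset.sum_congr rfl fun i _ => Finset.sum_congr rfl fun l _ => ?_
    have hσ : σ i l * (1 - z i * starRingEnd ℂ (z l)) = 1 := inv_mul_cancel₀ (hne i l)
    change _ = _ + (1 - z i * starRingEnd ℂ (z l)) * κ i l * _
    linear_combination -(inner ℂ (ContinuousLinearMap.adjoint (V i) (x i))
          (ContinuousLinearMap.adjoint (V l) (x l))) * hσ
  obtain ⟨A, B, C, D, hc, hrel⟩ :=
    exists_contractive_colligation Q.toLinearMap (Q.toLinearMap ∘ₗ Z) R G hisom
  have hmult := isContractiveMultiplier_rowMulCoeff hβ hmono hc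
  refine ⟨_, hmult, fun i => ?_⟩
  have hS := (hmult.summable_norm hβ hmono (hz i)).of_norm.hasSum
  suffices h : ∑' j, z i ^ j • rowMulCoeff β (transferCoeff A B C D) j = V i by rwa [h] at hS
  ext u
  refine ext_inner_left ℂ fun y => ?_
  let x : PiLp 2 (fun _ : Fin k => Y) := WithLp.toLp 2 (Pi.single i y)
  have hx : ∀ l, l ≠ i → x l = 0 := fun l hl => by simp [x, hl]
  have hxi : x i = y := by simp [x]
  have hZx : Z x = starRingEnd ℂ (z i) • x := by
    ext l
    rw [hZ, PiLp.smul_apply]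
    by_cases hl : l = i
    · rw [hl]
    · rw [hx l hl, smul_zero, smul_zero]
  have hRx : R x = ContinuousLinearMap.adjoint (V i) y := by
    rw [hR, Finset.sum_eq_single i (fun l _ hl => by rw [hx l hl, map_zero]) (by simp), hxi]
  have hGx : ∀ j, G x j = ((√(weightIncr β j) : ℂ) * (starRingEnd ℂ (z i)) ^ j) • y := fun j => by
    rw [hGapply, Finset.sum_eq_single i (fun l _ hl => by rw [hx l hl, smul_zero]) (by simp),
      hxi, smul_smul]
  have hrel' : ∀ p u, z i * inner ℂ (Q x) (A p + B u) + inner ℂ (G x) (C p + D u) =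
      inner ℂ (Q x) p + inner ℂ (R x) u := fun p u => by
    have h := hrel x p u
    rw [LinearMap.comp_apply, hZx, map_smul, inner_smul_left, Complex.conj_conj] at h
    exact h
  have h1 := hasSum_inner_rowMulCoeff hβ hmono (fun n u => norm_transferCoeff_apply_le hc u n) (hz i) hGx
    (hasSum_inner_transferCoeff hc (hz i) hrel' u)
  have h2 := (hS.mapL (ContinuousLinearMap.apply ℂ Y u)).mapL (innerSL ℂ y)
  rw [hRx, ContinuousLinearMap.adjoint_inner_left] at h1
  exact h2.unique h1

theorem stmt9 {U Y : Type*}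
    [NormedAddCommGroup U] [InnerProductSpace ℂ U] [CompleteSpace U]
    [NormedAddCommGroup Y] [InnerProductSpace ℂ Y] [CompleteSpace Y]
    (β : ℕ → ℝ) (hβ : IsWeightSeq β) (hmono : ∀ j, β (j + 1) ≤ β j)
    (k : ℕ) (z : Fin k → ℂ) (hz : ∀ i, z i ∈ ball (0 : ℂ) 1)
    (V : Fin k → (U →L[ℂ] Y)) :
    -- solvability of the Nevanlinna–Pick problem `S(z_i) = V_i` ...
    (∃ (S : ℂ → (U →L[ℂ] Y)) (Sc : ℕ → (U →L[ℂ] Y)),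
      (∀ w ∈ ball (0 : ℂ) 1, HasSum (fun j => w ^ j • Sc j) (S w)) ∧
      IsContractiveMultiplier β Sc ∧
      ∀ i, S (z i) = V i) ↔
    -- ... iff the block Pick matrix is positive semidefinite
    (∀ y : Fin k → Y,
      0 ≤ (∑ i, ∑ l, inner (𝕜 := ℂ) (y i)
            ((∑' j, (((β j)⁻¹ : ℝ) : ℂ) * (z i) ^ j * (starRingEnd ℂ (z l)) ^ j) • y l
              - (1 - z i * starRingEnd ℂ (z l))⁻¹ •
                  V i (ContinuousLinearMap.adjoint (V l) (y l)))).re ∧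
      (∑ i, ∑ l, inner (𝕜 := ℂ) (y i)
            ((∑' j, (((β j)⁻¹ : ℝ) : ℂ) * (z i) ^ j * (starRingEnd ℂ (z l)) ^ j) • y l
              - (1 - z i * starRingEnd ℂ (z l))⁻¹ •
                  V i (ContinuousLinearMap.adjoint (V l) (y l)))).im = 0) := by
  constructor
  · rintro ⟨S, Sc, hS, hSc, hV⟩ y
    exact ⟨hSc.pick_form_nonneg hβ hmono hz (fun i => hV i ▸ hS (z i) (hz i)) y,
      pick_form_im_eq_zero hβ hz V y⟩
  · intro hP
    obtain ⟨Sc, hSc, hV⟩ := exists_contractiveMultiplier_of_pick hβ hmono hz V hP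
    exact ⟨fun w => ∑' j, w ^ j • Sc j, Sc,
      fun w hw => (hSc.summable_norm hβ hmono hw).of_norm.hasSum, hSc, fun i => (hV i).tsum_eq⟩
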